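/- Let p = (1,0,0,0,0,0,0) ∈ S⁶, which lies in S⁶ \ T. The second homotopy group π₂(S⁶ \ T, p) is isomorphic, as a group, to the additive group of integers ℤ. -/

import Mathlib

/- STATEMENT 8: Let p = (1,0,0,0,0,0,0) ∈ S⁶, which lies in S⁶ \ T. Then
   π₂(S⁶ \ T, p) is isomorphic, as a group, to the additive group ℤ. -/

noncomputable section

abbrev E (n : ℕ) : Type := EuclideanSpace ℝ (Fin n)

/-- The standard torus `T ⊂ S⁶`. -/
def T : Set (E 7) :=
  {x | x ∈ Metric.sphere (0 : E 7) 1 ∧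
       x 0 ^ 2 + x 1 ^ 2 + x 2 ^ 2 = 1 / 2 ∧ x 3 ^ 2 + x 4 ^ 2 = 1 / 2}

/-- The base point `p = (1,0,0,0,0,0,0)`, as an element of `S⁶ \ T`. -/
def basePoint : (Metric.sphere (0 : E 7) 1 \ T : Set (E 7)) :=
  ⟨EuclideanSpace.single (0 : Fin 7) 1, by
    constructor
    · simp [mem_sphere_zero_iff_norm]
    · intro h
      have h2 := h.2.1
      simp [EuclideanSpace.single_apply] at h2⟩

section Avoidance

open Module unitInterval

/-- A map from the three-dimensional cube to a real vector space of dimension at least four can be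
changed away from a closed set on which it does not vanish so as to vanish nowhere. -/
theorem exists_nonvanishing_eqOn {V : Type*} [NormedAddCommGroup V] [NormedSpace ℝ V]
    [FiniteDimensional ℝ V] (hV : 3 < finrank ℝ V) {F : I × (Fin 2 → I) → V} (hF : Continuous F)
    {C : Set (I × (Fin 2 → I))} (hC : IsClosed C) (h0 : ∀ z ∈ C, F z ≠ 0) :
    ∃ Q : I × (Fin 2 → I) → V, Continuous Q ∧ (∀ z, Q z ≠ 0) ∧ ∀ z ∈ C, Q z = F z := by
  obtain ⟨δ, hδ, hδC⟩ : ∃ δ > 0, ∀ z ∈ C, δ ≤ ‖F z‖ := by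
    rcases C.eq_empty_or_nonempty with rfl | hne
    · exact ⟨1, one_pos, by simp⟩
    · obtain ⟨z, hz, hmin⟩ := hC.isCompact.exists_isMinOn hne hF.norm.continuousOn
      exact ⟨‖F z‖, norm_pos_iff.2 (h0 z hz), fun w hw => hmin hw⟩
  let pr : ℝ × (Fin 2 → ℝ) → I × (Fin 2 → I) := fun x =>
    (Set.projIcc 0 1 zero_le_one x.1, fun i => Set.projIcc 0 1 zero_le_one (x.2 i))
  have hpr : Continuous pr := by fun_prop
  obtain ⟨g, hg, hgF, -⟩ := (hF.comp hpr).exists_contDiff_approx 1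
    (ε := fun _ => δ / 8) continuous_const (fun _ => by positivity)
  have hd : finrank ℝ (ℝ × (Fin 2 → ℝ)) < finrank ℝ V := by simpa using hV
  obtain ⟨c, hc, hcδ⟩ := (hg.dense_compl_range_of_finrank_lt_finrank hd).exists_dist_lt
    (0 : V) (show 0 < δ / 8 by positivity)
  let incl : I × (Fin 2 → I) → ℝ × (Fin 2 → ℝ) := fun z => (z.1, fun i => z.2 i)
  have hincl : Continuous incl := by fun_prop
  have hpi : ∀ z, pr (incl z) = z := fun z => by simp [pr, incl]
  let P : I × (Fin 2 → I) → V := fun z => g (incl z) - c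
  have hP : Continuous P := by have := hg.continuous; fun_prop
  have hP0 : ∀ z, P z ≠ 0 := fun z h => hc ⟨incl z, sub_eq_zero.1 h⟩
  have hPF : ∀ z, ‖P z - F z‖ ≤ δ / 4 := fun z => by
    have h1 := hgF (incl z)
    rw [Function.comp_apply, hpi, dist_eq_norm] at h1
    rw [dist_eq_norm, zero_sub, norm_neg] at hcδ
    calc ‖P z - F z‖ = ‖(g (incl z) - F z) - c‖ := by congr 1; simp only [P]; abel
      _ ≤ ‖g (incl z) - F z‖ + ‖c‖ := norm_sub_le _ _
      _ ≤ δ / 4 := by linarith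
  let χ : I × (Fin 2 → I) → ℝ := fun z => max 0 (min 1 (2 - 2 * ‖F z‖ / δ))
  have hχ : Continuous χ := by fun_prop
  refine ⟨fun z => F z + χ z • (P z - F z), by fun_prop, fun z hz => ?_, fun z hz => ?_⟩
  · have hχ0 : 0 ≤ χ z := le_max_left _ _
    have hχ1 : χ z ≤ 1 := max_le zero_le_one (min_le_left _ _)
    rcases le_total (‖F z‖) (δ / 2) with hle | hge
    · have : χ z = 1 := by
        have : 1 ≤ 2 - 2 * ‖F z‖ / δ := by
          rw [le_sub_comm, div_le_iff₀ hδ]; linarith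
        simp [χ, this]
      apply hP0 z
      simpa [this] using hz
    · have h1 : ‖χ z • (P z - F z)‖ ≤ δ / 4 := by
        rw [norm_smul, Real.norm_of_nonneg hχ0]
        nlinarith [hPF z, norm_nonneg (P z - F z)]
      rw [eq_neg_of_add_eq_zero_left hz, norm_neg] at hge
      linarith
  · have : χ z = 0 := by
      have : 2 - 2 * ‖F z‖ / δ ≤ 0 := by
        rw [sub_nonpos, le_div_iff₀ hδ]; linarith [hδC z hz]
      simp [χ, this]
    simp [this]

end Avoidance

section Lifting

open unitInterval Quaternion

/-- Uniform continuity along the contraction of the interval, in `n` steps. -/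
theorem exists_subdivision {Y M : Type*} [PseudoMetricSpace Y] [CompactSpace Y]
    [PseudoMetricSpace M] {G : I × Y → M} (hG : Continuous G) {ε : ℝ} (hε : 0 < ε) :
    ∃ (n : ℕ) (c : ℕ → I), c 0 = 0 ∧ c n = 1 ∧
      ∀ k t y, dist (G (t * c (k + 1), y)) (G (t * c k, y)) < ε := by
  obtain ⟨δ, hδ, H⟩ := Metric.uniformContinuous_iff.1
    (CompactSpace.uniformContinuous_of_continuous hG) ε hε
  obtain ⟨n, hn⟩ := exists_nat_one_div_lt hδ
  have hn0 : (0 : ℝ) < n + 1 := by positivity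
  refine ⟨n + 1, fun k => Set.projIcc 0 1 zero_le_one ((k : ℝ) / (n + 1)), by simp, ?_,
    fun k t y => H ?_⟩
  · push_cast
    rw [div_self hn0.ne']
    exact Set.projIcc_right (h := zero_le_one)
  · rw [Prod.dist_eq, max_lt_iff]
    refine ⟨?_, by simpa using hδ⟩
    rw [Subtype.dist_eq, Set.Icc.coe_mul, Set.Icc.coe_mul, Real.dist_eq, ← mul_sub, abs_mul,
      abs_of_nonneg t.2.1]
    have h1 : |((Set.projIcc 0 1 zero_le_one (((k + 1 : ℕ) : ℝ) / (n + 1)) : I) : ℝ)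
        - (Set.projIcc 0 1 zero_le_one ((k : ℝ) / (n + 1)) : I)| ≤ 1 / (n + 1) := by
      refine (Set.abs_projIcc_sub_projIcc zero_le_one).trans ?_
      rw [← sub_div, abs_div, abs_of_pos hn0]
      simp
    calc _ ≤ 1 * (1 / ((n : ℝ) + 1)) :=
          mul_le_mul t.2.2 h1 (abs_nonneg _) zero_le_one
      _ < δ := by simpa using hn

/-- A homotopy of unit imaginary quaternions is realised by conjugation. -/
theorem exists_conjugating_lift {Y : Type*} [PseudoMetricSpace Y] [CompactSpace Y]
    {G : I × Y → ℍ[ℝ]} (hG : Continuous G) (hG1 : ∀ z, G z * G z = -1) :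
    ∃ P : I × Y → ℍ[ℝ], Continuous P ∧ (∀ z, P z ≠ 0) ∧ (∀ y, P (0, y) = 1) ∧
      (∀ t y, P (t, y) * G (0, y) = G (t, y) * P (t, y)) ∧
      ∀ y, (∀ t, G (t, y) = G (0, y)) → ∀ t, P (t, y) = 1 := by
  obtain ⟨n, c, c0, cn, hc⟩ := exists_subdivision hG (show (0 : ℝ) < 1 by norm_num)
  suffices H : ∀ k, ∃ P : I × Y → ℍ[ℝ], Continuous P ∧ (∀ z, P z ≠ 0) ∧ (∀ y, P (0, y) = 1) ∧
      (∀ t y, P (t, y) * G (0, y) = G (t * c k, y) * P (t, y)) ∧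
      ∀ y, (∀ t, G (t, y) = G (0, y)) → ∀ t, P (t, y) = 1 by
    simpa [cn] using H n
  intro k
  induction k with
  | zero => exact ⟨fun _ => 1, continuous_const, by simp, by simp, by simp [c0], by simp⟩
  | succ k ih =>
    obtain ⟨P, hP, hP0, hP1, hPG, hPc⟩ := ih
    let R : I × Y → ℍ[ℝ] := fun z =>
      (1 / 2 : ℝ) • (1 - G (z.1 * c (k + 1), z.2) * G (z.1 * c k, z.2))
    have hR1 : ∀ z, G (z.1 * c (k + 1), z.2) = G (z.1 * c k, z.2) → R z = 1 := fun z h => by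
      simp only [R, h, hG1, sub_neg_eq_add]
      rw [← two_smul ℝ (1 : ℍ[ℝ]), smul_smul]
      norm_num
    refine ⟨fun z => R z * P z, by fun_prop, fun z => mul_ne_zero (fun h => ?_) (hP0 z),
      fun y => ?_, fun t y => ?_, fun y hy t => ?_⟩
    · set x := G (z.1 * c k, z.2) with hx
      set y := G (z.1 * c (k + 1), z.2) with hy
      have hxy : y * x = 1 := by
        have := (smul_eq_zero_iff_right (by norm_num)).1 h
        exact (sub_eq_zero.1 this).symm
      have h1 : y = -x := by
        have : y * (x * x) = x := by rw [← mul_assoc, hxy, one_mul]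
        rw [hG1] at this
        rw [← this]; simp
      have h2 := hc k z.1 z.2
      rw [← hx, ← hy, h1, dist_eq_norm] at h2
      have h3 : ‖x‖ * ‖x‖ = 1 := by rw [← norm_mul, hG1]; simp
      have h4 : ‖-x - x‖ = 2 * ‖x‖ := by
        rw [show -x - x = (-2 : ℝ) • x by rw [neg_smul, two_smul]; abel, norm_smul]
        norm_num
      nlinarith [norm_nonneg x]
    · simp only [hP1, mul_one]
      exact hR1 _ (by simp)
    · rw [mul_assoc, hPG, ← mul_assoc, ← mul_assoc]
      congr 1
      simp only [R]
      rw [smul_mul_assoc, mul_smul_comm, sub_mul, mul_sub, mul_assoc, hG1, ← mul_assoc, hG1]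
      simp [add_comm]
    · dsimp only
      rw [hPc y hy, mul_one]
      exact hR1 _ (by rw [hy, hy (t * c k)])

/-- Complex logarithms lift along homotopies starting at `1`. -/
theorem exists_log_lift {Y : Type*} [PseudoMetricSpace Y] [CompactSpace Y]
    {f : I × Y → ℂ} (hf : Continuous f) (hf0 : ∀ z, f z ≠ 0) (hf1 : ∀ y, f (0, y) = 1) :
    ∃ θ : I × Y → ℂ, Continuous θ ∧ (∀ z, Complex.exp (θ z) = f z) ∧ (∀ y, θ (0, y) = 0) ∧
      ∀ y, (∀ t, f (t, y) = 1) → ∀ t, θ (t, y) = 0 := by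
  obtain ⟨δ, hδ, hδf⟩ : ∃ δ > 0, ∀ z, δ ≤ ‖f z‖ := by
    rcases isEmpty_or_nonempty Y with h | h
    · exact ⟨1, one_pos, fun z => isEmptyElim z.2⟩
    · obtain ⟨z, -, hmin⟩ := isCompact_univ.exists_isMinOn Set.univ_nonempty hf.norm.continuousOn
      exact ⟨‖f z‖, norm_pos_iff.2 (hf0 z), fun w => hmin (Set.mem_univ w)⟩
  obtain ⟨n, c, c0, cn, hc⟩ := exists_subdivision hf hδ
  suffices H : ∀ k, ∃ θ : I × Y → ℂ, Continuous θ ∧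
      (∀ z, Complex.exp (θ z) = f (z.1 * c k, z.2)) ∧ (∀ y, θ (0, y) = 0) ∧
      ∀ y, (∀ t, f (t, y) = 1) → ∀ t, θ (t, y) = 0 by
    simpa [cn] using H n
  intro k
  induction k with
  | zero => exact ⟨fun _ => 0, continuous_const, by simp [c0, hf1], by simp, by simp⟩
  | succ k ih =>
    obtain ⟨θ, hθ, hθf, hθ0, hθc⟩ := ih
    let r : I × Y → ℂ := fun z => f (z.1 * c (k + 1), z.2) / f (z.1 * c k, z.2)
    have hr : Continuous r := by
      refine Continuous.div (by fun_prop) (by fun_prop) fun z => hf0 _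
    have hr0 : ∀ z, r z ≠ 0 := fun z => div_ne_zero (hf0 _) (hf0 _)
    have hrs : ∀ z, r z ∈ Complex.slitPlane := fun z => by
      have h1 : ‖r z - 1‖ < 1 := by
        have := hc k z.1 z.2
        rw [dist_eq_norm] at this
        simp only [r]
        rw [div_sub_one (hf0 _), norm_div, div_lt_one (norm_pos_iff.2 (hf0 _))]
        exact this.trans_le (hδf _)
      refine Or.inl ?_
      have := (Complex.abs_re_le_norm (r z - 1)).trans_lt h1
      rw [Complex.sub_re, Complex.one_re, abs_lt] at this
      linarith
    refine ⟨fun z => Complex.log (r z) + θ z, (hr.clog hrs).add hθ, fun z => ?_, fun y => ?_,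
      fun y hy t => ?_⟩
    · rw [Complex.exp_add, Complex.exp_log (hr0 z), hθf, div_mul_cancel₀ _ (hf0 _)]
    · simp [r, hf1, hθ0]
    · simp [r, hy, hθc y hy]

end Lifting

section Degree

open unitInterval Quaternion Topology

/-- The quaternion unit `i`, as the image of the complex imaginary unit. -/
abbrev quatI : ℍ[ℝ] := ((Complex.I : ℂ) : ℍ[ℝ])

theorem quatI_mul_self : quatI * quatI = -1 := by
  rw [quatI, ← Quaternion.coeComplex_mul, Complex.I_mul_I]
  ext <;> simp

theorem conj_quatI_mul_self {q : ℍ[ℝ]} (hq : q ≠ 0) :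
    q * quatI * q⁻¹ * (q * quatI * q⁻¹) = -1 := by
  have : q * quatI * q⁻¹ * (q * quatI * q⁻¹) = q * (quatI * (q⁻¹ * q) * quatI) * q⁻¹ := by
    simp only [mul_assoc]
  rw [this, inv_mul_cancel₀ hq, mul_one, quatI_mul_self, mul_neg, mul_one, neg_mul,
    mul_inv_cancel₀ hq]

theorem coeComplex_mul_quatI (z : ℂ) : (z : ℍ[ℝ]) * quatI = quatI * z := by
  rw [quatI, ← Quaternion.coeComplex_mul, ← Quaternion.coeComplex_mul, mul_comm]

theorem coeComplex_injective : Function.Injective (fun z : ℂ => (z : ℍ[ℝ])) := fun z w h => by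
  have h1 := congrArg QuaternionAlgebra.re h
  have h2 := congrArg QuaternionAlgebra.imI h
  exact Complex.ext (by simpa using h1) (by simpa using h2)

@[fun_prop]
theorem continuous_coeComplex : Continuous (fun z : ℂ => (z : ℍ[ℝ])) := by
  have : (fun z : ℂ => (z : ℍ[ℝ])) = fun z : ℂ => (z.re : ℍ[ℝ]) + (z.im : ℍ[ℝ]) * quatI := by
    funext z; ext <;> simp
  rw [this]
  have := Quaternion.continuous_coe
  fun_prop

/-- The complex part of a quaternion. -/
def quatToComplex (q : ℍ[ℝ]) : ℂ := q.re + q.imI * Complex.I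

@[fun_prop]
theorem continuous_quatToComplex : Continuous quatToComplex := by
  have := Quaternion.continuous_re
  have := Quaternion.continuous_imI
  unfold quatToComplex
  fun_prop

theorem coe_quatToComplex {q : ℍ[ℝ]} (h : q * quatI = quatI * q) :
    ((quatToComplex q : ℂ) : ℍ[ℝ]) = q := by
  have h1 := congrArg QuaternionAlgebra.imJ h
  have h2 := congrArg QuaternionAlgebra.imK h
  simp at h1 h2
  ext <;> simp [quatToComplex] <;> linarith

theorem quatToComplex_one : quatToComplex 1 = 1 := by simp [quatToComplex]

/-- A square of unit imaginary quaternions has degree `n` if it is the conjugate of `i` by a square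
of nonzero quaternions equal to `1` on three sides and winding `n` times on the fourth. -/
def IsDegree (G : (Fin 2 → I) → ℍ[ℝ]) (n : ℤ) : Prop :=
  ∃ q : (Fin 2 → I) → ℍ[ℝ], Continuous q ∧ (∀ y, q y ≠ 0) ∧ (∀ y, q y * quatI = G y * q y) ∧
    (∀ y, y 0 = 0 ∨ y 1 = 0 ∨ y 1 = 1 → q y = 1) ∧
    ∀ y, y 0 = 1 → q y = (Complex.exp (n * (2 * Real.pi * Complex.I) * (y 1 : ℝ)) : ℂ)

theorem isDegree_of_log {G : (Fin 2 → I) → ℍ[ℝ]} {n : ℤ} {q : (Fin 2 → I) → ℍ[ℝ]}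
    (hq : Continuous q) (hq0 : ∀ y, q y ≠ 0) (hqG : ∀ y, q y * quatI = G y * q y)
    (hq1 : ∀ y, y 0 = 0 ∨ y 1 = 0 ∨ y 1 = 1 → q y = 1) {θ : I → ℂ} (hθ : Continuous θ)
    (hθ0 : θ 0 = 0) (hθ1 : θ 1 = n * (2 * Real.pi * Complex.I))
    (hqθ : ∀ y, y 0 = 1 → q y = (Complex.exp (θ (y 1)) : ℂ)) : IsDegree G n := by
  let e : (Fin 2 → I) → ℂ := fun y =>
    Complex.exp ((y 0 : ℝ) * (n * (2 * Real.pi * Complex.I) * (y 1 : ℝ) - θ (y 1)))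
  have he : Continuous e := by fun_prop
  have he0 : ∀ y, ((e y : ℂ) : ℍ[ℝ]) ≠ 0 := fun y h =>
    Complex.exp_ne_zero _ (coeComplex_injective (h.trans Quaternion.coeComplex_zero.symm))
  refine ⟨fun y => q y * (e y : ℂ), by fun_prop, fun y => mul_ne_zero (hq0 y) (he0 y), fun y => ?_,
    fun y hy => ?_, fun y hy => ?_⟩
  · rw [mul_assoc, coeComplex_mul_quatI, ← mul_assoc, hqG, mul_assoc]
  · have : e y = 1 := by
      rcases hy with h | h | h <;> simp [e, h, hθ0, hθ1]
    simp [hq1 y hy, this]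
  · simp only [e]
    rw [hqθ y hy, ← Quaternion.coeComplex_mul, ← Complex.exp_add, hy]
    congr 2
    simp

theorem exists_isDegree {G : (Fin 2 → I) → ℍ[ℝ]} (hG : Continuous G) (hG1 : ∀ y, G y * G y = -1)
    (hGb : ∀ y ∈ Cube.boundary (Fin 2), G y = quatI) : ∃ n, IsDegree G n := by
  have hb : ∀ t s : I, (t = 0 ∨ t = 1) ∨ (s = 0 ∨ s = 1) → G ![t, s] = quatI := by
    rintro t s (h | h)
    · exact hGb _ ⟨0, h⟩
    · exact hGb _ ⟨1, h⟩
  have hvec : Continuous fun z : I × I => (![z.1, z.2] : Fin 2 → I) := by fun_prop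
  obtain ⟨P, hP, hP0, hP1, hPG, hPc⟩ := exists_conjugating_lift (Y := I)
    (G := fun z => G ![z.1, z.2]) (hG.comp hvec) (fun z => hG1 _)
  have hside : ∀ t s : I, s = 0 ∨ s = 1 → P (t, s) = 1 := fun t s hs =>
    hPc s (fun t => by rw [hb _ _ (.inr hs), hb _ _ (.inr hs)]) t
  have hcomm : ∀ s, P (1, s) * quatI = quatI * P (1, s) := fun s => by
    have := hPG 1 s
    dsimp only at this
    rwa [hb _ _ (.inl (.inl rfl)), hb _ _ (.inl (.inr rfl))] at this
  let w : I → ℂ := fun s => quatToComplex (P (1, s))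
  have hw : Continuous w := by fun_prop
  have hwP : ∀ s, ((w s : ℂ) : ℍ[ℝ]) = P (1, s) := fun s => coe_quatToComplex (hcomm s)
  have hw0 : ∀ s, w s ≠ 0 := fun s h => hP0 (1, s) (by rw [← hwP, h, Quaternion.coeComplex_zero])
  have hw1 : ∀ s, s = 0 ∨ s = 1 → w s = 1 := fun s hs => by
    simp only [w, hside 1 s hs, quatToComplex_one]
  obtain ⟨θ, hθ, hθw, hθ0, -⟩ := exists_log_lift (Y := Unit) (f := fun z => w z.1) (by fun_prop)
    (fun z => hw0 _) (fun _ => hw1 0 (.inl rfl))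
  have hθ1 : Complex.exp (θ (1, ())) = 1 := (hθw _).trans (hw1 1 (.inr rfl))
  obtain ⟨n, hn⟩ := Complex.exp_eq_one_iff.1 hθ1
  refine ⟨n, isDegree_of_log (q := fun y => P (y 0, y 1)) (θ := fun s => θ (s, ())) (by fun_prop)
    (fun y => hP0 _) (fun y => ?_) (fun y hy => ?_) (by fun_prop) (hθ0 _) hn (fun y hy => ?_)⟩
  · have := hPG (y 0) (y 1)
    dsimp only at this
    rw [hb _ _ (.inl (.inl rfl))] at this
    rw [this]
    congr 2
    ext i; fin_cases i <;> rfl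
  · rcases hy with h | h
    · simp only [h, hP1]
    · exact hside _ _ h
  · rw [hy, hθw, hwP]

theorem IsDegree.of_homotopy {H : I × (Fin 2 → I) → ℍ[ℝ]} (hH : Continuous H)
    (hH1 : ∀ z, H z * H z = -1) (hHb : ∀ t, ∀ y ∈ Cube.boundary (Fin 2), H (t, y) = H (0, y))
    {n : ℤ} (h : IsDegree (fun y => H (0, y)) n) : IsDegree (fun y => H (1, y)) n := by
  obtain ⟨q, hq, hq0, hqG, hq1, hqn⟩ := h
  obtain ⟨P, hP, hP0, -, hPG, hPc⟩ := exists_conjugating_lift hH hH1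
  have hPb : ∀ y ∈ Cube.boundary (Fin 2), P (1, y) = 1 := fun y hy =>
    hPc y (fun t => hHb t y hy) 1
  refine ⟨fun y => P (1, y) * q y, by fun_prop, fun y => mul_ne_zero (hP0 _) (hq0 y), fun y => ?_,
    fun y hy => ?_, fun y hy => ?_⟩
  · rw [mul_assoc, hqG, ← mul_assoc, hPG, mul_assoc]
  · have : y ∈ Cube.boundary (Fin 2) := by
      rcases hy with h | h | h
      exacts [⟨0, .inl h⟩, ⟨1, .inl h⟩, ⟨1, .inr h⟩]
    simp only [hPb y this, hq1 y hy, mul_one]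
  · simp only [hPb y ⟨0, .inr hy⟩, hqn y hy, one_mul]

theorem eq_of_continuous_of_integer_valued {f : I → ℝ} (hf : Continuous f)
    (hfi : ∀ s, ∃ k : ℤ, f s = k) : f 0 = f 1 := by
  choose k hk using hfi
  have hfk : f = fun s => (k s : ℝ) := funext hk
  have hkc : Continuous k := by
    rw [Int.isClosedEmbedding_coe_real.isInducing.continuous_iff]
    rwa [hfk] at hf
  rw [hk, hk, PreconnectedSpace.constant (inferInstance : PreconnectedSpace I) hkc (x := 0) (y := 1)]

theorem IsDegree.unique {G : (Fin 2 → I) → ℍ[ℝ]} {m n : ℤ} (hm : IsDegree G m)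
    (hn : IsDegree G n) : m = n := by
  obtain ⟨q, hq, hq0, hqG, hq1, hqm⟩ := hm
  obtain ⟨q', hq', hq0', hqG', hq1', hqn⟩ := hn
  have hcomm : ∀ y, ((q y)⁻¹ * q' y) * quatI = quatI * ((q y)⁻¹ * q' y) := fun y => by
    have h1 : quatI * (q y)⁻¹ = (q y)⁻¹ * G y := by
      rw [eq_inv_mul_iff_mul_eq₀ (hq0 y), ← mul_assoc, hqG, mul_assoc, mul_inv_cancel₀ (hq0 y),
        mul_one]
    rw [mul_assoc, hqG', ← mul_assoc, ← mul_assoc, h1]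
  let f : I × I → ℂ := fun z => quatToComplex ((q ![z.1, z.2])⁻¹ * q' ![z.1, z.2])
  have hfq : ∀ z, ((f z : ℂ) : ℍ[ℝ]) = (q ![z.1, z.2])⁻¹ * q' ![z.1, z.2] := fun z =>
    coe_quatToComplex (hcomm _)
  have hvec : Continuous fun z : I × I => (![z.1, z.2] : Fin 2 → I) := by fun_prop
  have hf : Continuous f := continuous_quatToComplex.comp
    (((hq.comp hvec).inv₀ fun z => hq0 _).mul (hq'.comp hvec))
  have hf0 : ∀ z, f z ≠ 0 := fun z h => by
    have := hfq z
    rw [h, Quaternion.coeComplex_zero] at this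
    exact mul_ne_zero (inv_ne_zero (hq0 _)) (hq0' _) this.symm
  have hf1 : ∀ t s : I, t = 0 ∨ s = 0 ∨ s = 1 → f (t, s) = 1 := fun t s h => by
    simp only [f]
    rw [hq1 ![t, s] h, hq1' ![t, s] h, inv_one, mul_one, quatToComplex_one]
  obtain ⟨θ, hθ, hθf, -, hθc⟩ := exists_log_lift hf hf0 (fun y => hf1 0 y (.inl rfl))
  have hend : ∀ s, f (1, s) = Complex.exp (((n - m : ℤ) : ℂ) * (2 * Real.pi * Complex.I) * (s : ℝ)) :=
    fun s => by
    have h1 := hfq (1, s)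
    dsimp only at h1
    rw [hqm ![1, s] rfl, hqn ![1, s] rfl, eq_inv_mul_iff_mul_eq₀, ← Quaternion.coeComplex_mul] at h1
    · have h2 := coeComplex_injective h1
      rw [← mul_right_inj' (Complex.exp_ne_zero _), h2, ← Complex.exp_add]
      congr 1
      simp
      ring
    · rw [← hqm ![1, s] rfl]
      exact hq0 _
  have key := eq_of_continuous_of_integer_valued
    (f := fun s : I => (θ (1, s)).im / (2 * Real.pi) - (n - m : ℤ) * (s : ℝ)) (by fun_prop)
    (fun s => by
      have h1 := (hθf (1, s)).trans (hend s)
      obtain ⟨k, hk⟩ := Complex.exp_eq_exp_iff_exists_int.1 h1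
      refine ⟨k, ?_⟩
      rw [hk]
      simp
      field_simp
      ring)
  rw [hθc 0 (fun t => hf1 t 0 (.inr (.inl rfl))) 1, hθc 1 (fun t => hf1 t 1 (.inr (.inr rfl))) 1] at key
  simp only [Complex.zero_im, zero_div, Set.Icc.coe_zero, Set.Icc.coe_one, mul_zero, mul_one,
    sub_zero, zero_sub, zero_eq_neg] at key
  have : n - m = 0 := by exact_mod_cast key
  omega

theorem IsDegree.concat {G G₁ G₂ : (Fin 2 → I) → ℍ[ℝ]} {m n : ℤ} (hm : IsDegree G₁ m)
    (hn : IsDegree G₂ n)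
    (hG : ∀ y, G y = if (y 1 : ℝ) ≤ 1 / 2
      then G₁ (Function.update y 1 (Set.projIcc 0 1 zero_le_one (2 * y 1)))
      else G₂ (Function.update y 1 (Set.projIcc 0 1 zero_le_one (2 * y 1 - 1)))) :
    IsDegree G (m + n) := by
  obtain ⟨q, hq, hq0, hqG, hq1, hqm⟩ := hm
  obtain ⟨q', hq', hq0', hqG', hq1', hqn⟩ := hn
  let l : ℝ → I := fun s => Set.projIcc 0 1 zero_le_one (2 * s)
  let r : ℝ → I := fun s => Set.projIcc 0 1 zero_le_one (2 * s - 1)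
  have hl : Continuous l := by fun_prop
  have hr : Continuous r := by fun_prop
  have hl1 : ∀ s : ℝ, 1 / 2 ≤ s → l s = 1 := fun s hs =>
    Set.projIcc_of_right_le zero_le_one (by linarith)
  have hr0 : ∀ s : ℝ, s ≤ 1 / 2 → r s = 0 := fun s hs =>
    Set.projIcc_of_le_left zero_le_one (by linarith)
  have hl0 : l 0 = 0 := Set.projIcc_of_le_left zero_le_one (by norm_num)
  have hr1 : r 1 = 1 := Set.projIcc_of_right_le zero_le_one (by norm_num)
  refine isDegree_of_log
    (q := fun y => q (Function.update y 1 (l (y 1))) * q' (Function.update y 1 (r (y 1))))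
    (θ := fun s => m * (2 * Real.pi * Complex.I) * (l s : ℝ)
      + n * (2 * Real.pi * Complex.I) * (r s : ℝ))
    ?_ (fun y => mul_ne_zero (hq0 _) (hq0' _)) (fun y => ?_) (fun y hy => ?_) ?_ ?_ ?_
    (fun y hy => ?_)
  · have h1 : Continuous fun y : Fin 2 → I => Function.update y 1 (l (y 1)) :=
      continuous_id.update 1 (by fun_prop)
    have h2 : Continuous fun y : Fin 2 → I => Function.update y 1 (r (y 1)) :=
      continuous_id.update 1 (by fun_prop)
    exact (hq.comp h1).mul (hq'.comp h2)
  · rw [hG]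
    split_ifs with h
    · rw [hq1' (Function.update y 1 (r (y 1))) (.inr (.inl (by simp [hr0 _ h]))), mul_one]
      exact hqG _
    · rw [hq1 (Function.update y 1 (l (y 1))) (.inr (.inr (by simp [hl1 _ (not_le.1 h).le]))),
        one_mul]
      exact hqG' _
  · have h1 : q (Function.update y 1 (l (y 1))) = 1 := by
      apply hq1
      rcases hy with h | h | h
      · exact .inl (by simp [h])
      · exact .inr (.inl (by simp [h, hl0]))
      · exact .inr (.inr (by simp [h, hl1 1 (by norm_num)]))
    have h2 : q' (Function.update y 1 (r (y 1))) = 1 := by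
      apply hq1'
      rcases hy with h | h | h
      · exact .inl (by simp [h])
      · exact .inr (.inl (by simp [h, hr0 0 (by norm_num)]))
      · exact .inr (.inr (by simp [h, hr1]))
    simp only [h1, h2, mul_one]
  · fun_prop
  · simp [hl0, hr0 0 (by norm_num)]
  · simp [hl1 1 (by norm_num), hr1]
    ring
  · rw [hqm _ (by simpa using hy), hqn _ (by simpa using hy), ← Quaternion.coeComplex_mul,
      ← Complex.exp_add]
    simp

theorem isClosed_cubeBoundary : IsClosed (Cube.boundary (Fin 2)) := by
  have : Cube.boundary (Fin 2) = ⋃ i : Fin 2, ({y | y i = 0} ∪ {y | y i = 1}) := by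
    ext y; simp [Cube.boundary]
  rw [this]
  exact isClosed_iUnion_of_finite fun i =>
    (isClosed_eq (continuous_apply i) continuous_const).union
      (isClosed_eq (continuous_apply i) continuous_const)

theorem IsDegree.exists_nullhomotopy {G : (Fin 2 → I) → ℍ[ℝ]} (h : IsDegree G 0) :
    ∃ H : I × (Fin 2 → I) → ℍ[ℝ], Continuous H ∧ (∀ z, H z * H z = -1) ∧ (∀ y, H (0, y) = G y) ∧
      (∀ y, H (1, y) = quatI) ∧ ∀ t, ∀ y ∈ Cube.boundary (Fin 2), H (t, y) = quatI := by
  obtain ⟨q, hq, hq0, hqG, hq1, hqn⟩ := h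
  have hqb : ∀ y ∈ Cube.boundary (Fin 2), q y = 1 := by
    rintro y ⟨i, hi⟩
    fin_cases i
    · rcases hi with hi | hi
      · exact hq1 y (.inl hi)
      · simp [hqn y hi]
    · exact hq1 y (.inr hi)
  let F : I × (Fin 2 → I) → ℍ[ℝ] := fun z => (1 - (z.1 : ℝ)) • q z.2 + (z.1 : ℝ) • 1
  have hFb : ∀ t, ∀ y ∈ Cube.boundary (Fin 2), F (t, y) = 1 := fun t y hy => by
    simp only [F, hqb y hy]
    rw [← add_smul]
    simp
  have hF0 : ∀ y, F (0, y) = q y := fun y => by simp [F]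
  have hF1 : ∀ y, F (1, y) = 1 := fun y => by simp [F]
  let C : Set (I × (Fin 2 → I)) := {z | z.1 = 0} ∪ {z | z.1 = 1} ∪ Prod.snd ⁻¹' Cube.boundary (Fin 2)
  have hC : IsClosed C := ((isClosed_eq continuous_fst continuous_const).union
    (isClosed_eq continuous_fst continuous_const)).union
      (isClosed_cubeBoundary.preimage continuous_snd)
  obtain ⟨Q, hQ, hQ0, hQF⟩ := exists_nonvanishing_eqOn (by rw [Quaternion.finrank_eq_four]; norm_num)
    (show Continuous F by fun_prop) hC (by
      rintro ⟨t, y⟩ (((rfl : t = 0) | (rfl : t = 1)) | hy)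
      · rw [hF0]; exact hq0 y
      · rw [hF1]; exact one_ne_zero
      · rw [hFb t y hy]; exact one_ne_zero)
  refine ⟨fun z => Q z * quatI * (Q z)⁻¹, (hQ.mul continuous_const).mul (hQ.inv₀ hQ0), fun z => ?_,
    fun y => ?_, fun y => ?_, fun t y hy => ?_⟩
  · exact conj_quatI_mul_self (hQ0 z)
  · dsimp only
    rw [hQF (0, y) (.inl (.inl rfl)), hF0, hqG, mul_assoc, mul_inv_cancel₀ (hq0 y), mul_one]
  · dsimp only
    rw [hQF (1, y) (.inl (.inr rfl)), hF1]
    simp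
  · dsimp only
    rw [hQF (t, y) (.inr hy), hFb t y hy]
    simp

theorem exists_of_degree (n : ℤ) : ∃ G : (Fin 2 → I) → ℍ[ℝ], Continuous G ∧
    (∀ y, G y * G y = -1) ∧ (∀ y ∈ Cube.boundary (Fin 2), G y = quatI) ∧ IsDegree G n := by
  let w : (Fin 2 → I) → ℂ := fun y => Complex.exp (n * (2 * Real.pi * Complex.I) * (y 1 : ℝ))
  let b : (Fin 2 → I) → ℂ := fun y => (1 - (y 0 : ℝ)) + (y 0 : ℝ) * w y
  let ρ : (Fin 2 → I) → ℝ := fun y => (y 0 : ℝ) * (1 - y 0) * (y 1 * (1 - y 1))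
  let j : ℍ[ℝ] := ⟨0, 0, 1, 0⟩
  let q : (Fin 2 → I) → ℍ[ℝ] := fun y => (b y : ℂ) + ρ y • j
  have hw : Continuous w := by fun_prop
  have hb : Continuous b := by fun_prop
  have hq : Continuous q := by fun_prop
  have hρ : ∀ y ∈ Cube.boundary (Fin 2), ρ y = 0 := by
    rintro y ⟨i, hi⟩
    fin_cases i <;> rcases hi with hi | hi <;> simp at hi <;> simp [ρ, hi]
  have hw1 : ∀ y, y 1 = 0 ∨ y 1 = 1 → w y = 1 := by
    rintro y (hy | hy) <;> simp [w, hy]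
  have hside : ∀ y, y 0 = 0 ∨ y 1 = 0 ∨ y 1 = 1 → q y = 1 := by
    intro y hy
    have h1 : b y = 1 := by
      rcases hy with h | h
      · simp [b, h]
      · simp [b, hw1 y h]
    have h2 : ρ y = 0 := by
      rcases hy with h | h | h <;> simp [ρ, h]
    simp [q, h1, h2]
  have hend : ∀ y, y 0 = 1 → q y = (w y : ℂ) := by
    intro y hy
    simp [q, b, ρ, hy]
  have hq0 : ∀ y, q y ≠ 0 := by
    intro y h
    have h1 : ρ y = 0 := by
      have := congrArg QuaternionAlgebra.imJ h
      change (b y : ℍ[ℝ]).imJ + ρ y * 1 = 0 at this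
      simpa using this
    have h2 : y 0 = 0 ∨ y 0 = 1 ∨ y 1 = 0 ∨ y 1 = 1 := by
      have h3 : ((y 0 : ℝ) = 0 ∨ 1 - (y 0 : ℝ) = 0) ∨ ((y 1 : ℝ) = 0 ∨ 1 - (y 1 : ℝ) = 0) := by
        simpa only [ρ, mul_eq_zero] using h1
      rcases h3 with (h3 | h3) | (h3 | h3)
      · exact .inl (Subtype.ext h3)
      · exact .inr (.inl (Subtype.ext (sub_eq_zero.1 h3).symm))
      · exact .inr (.inr (.inl (Subtype.ext h3)))
      · exact .inr (.inr (.inr (Subtype.ext (sub_eq_zero.1 h3).symm)))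
    by_cases h4 : y 0 = 1
    · rw [hend y h4] at h
      exact Complex.exp_ne_zero _ (coeComplex_injective (h.trans Quaternion.coeComplex_zero.symm))
    · rw [hside y (by tauto)] at h
      exact one_ne_zero h
  refine ⟨fun y => q y * quatI * (q y)⁻¹, (hq.mul continuous_const).mul (hq.inv₀ hq0), fun y => ?_,
    fun y hy => ?_, q, hq, hq0, fun y => ?_, hside, hend⟩
  · exact conj_quatI_mul_self (hq0 y)
  · have : q y = (b y : ℂ) := by simp [q, hρ y hy]
    have h0 := hq0 y
    rw [this] at h0
    simp only [this]
    rw [coeComplex_mul_quatI, mul_assoc, mul_inv_cancel₀ h0, mul_one]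
  · rw [mul_assoc, inv_mul_cancel₀ (hq0 y), mul_one]

end Degree

section Geometry

open unitInterval Quaternion Topology Topology.Homotopy

/-- The norm of the first three coordinates. -/
def uNorm (x : E 7) : ℝ := √(x 0 ^ 2 + x 1 ^ 2 + x 2 ^ 2)

/-- The norm of the fourth and fifth coordinates. -/
def vNorm (x : E 7) : ℝ := √(x 3 ^ 2 + x 4 ^ 2)

/-- The difference of the norms of the first two blocks of coordinates. -/
def height (x : E 7) : ℝ := uNorm x - vNorm x

/-- The vector does not lie on the cone over `T`. -/
def Avoids (x : E 7) : Prop := height x ≠ 0 ∨ x 5 ≠ 0 ∨ x 6 ≠ 0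

@[fun_prop]
theorem continuous_height : Continuous height := by
  unfold height uNorm vNorm
  fun_prop

theorem height_smul {c : ℝ} (hc : 0 ≤ c) (x : E 7) : height (c • x) = c * height x := by
  have h1 : (c * x 0) ^ 2 + (c * x 1) ^ 2 + (c * x 2) ^ 2
      = c ^ 2 * (x 0 ^ 2 + x 1 ^ 2 + x 2 ^ 2) := by ring
  have h2 : (c * x 3) ^ 2 + (c * x 4) ^ 2 = c ^ 2 * (x 3 ^ 2 + x 4 ^ 2) := by ring
  simp only [height, uNorm, vNorm, PiLp.smul_apply, smul_eq_mul, h1, h2]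
  rw [Real.sqrt_mul (sq_nonneg c), Real.sqrt_mul (sq_nonneg c), Real.sqrt_sq hc]
  ring

theorem Avoids.smul {c : ℝ} (hc : 0 < c) {x : E 7} (hx : Avoids x) : Avoids (c • x) := by
  simpa [Avoids, height_smul hc.le, hc.ne'] using hx

theorem Avoids.ne_zero {x : E 7} (hx : Avoids x) : x ≠ 0 := by
  rintro rfl
  simp [Avoids, height, uNorm, vNorm] at hx

theorem norm_sq_eq_sum (x : E 7) : ‖x‖ ^ 2 =
    (x 0 ^ 2 + x 1 ^ 2 + x 2 ^ 2) + (x 3 ^ 2 + x 4 ^ 2) + (x 5 ^ 2 + x 6 ^ 2) := by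
  rw [EuclideanSpace.real_norm_sq_eq]
  simp only [Fin.sum_univ_succ, Fin.sum_univ_zero]
  simp [← add_assoc]

theorem mem_complement_iff {x : E 7} :
    x ∈ Metric.sphere (0 : E 7) 1 \ T ↔ ‖x‖ = 1 ∧ Avoids x := by
  rw [Set.mem_sdiff, mem_sphere_zero_iff_norm]
  refine and_congr_right fun hx => ?_
  have hs := norm_sq_eq_sum x
  rw [hx] at hs
  have hu : 0 ≤ x 0 ^ 2 + x 1 ^ 2 + x 2 ^ 2 := by positivity
  have hv : 0 ≤ x 3 ^ 2 + x 4 ^ 2 := by positivity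
  rw [← not_iff_not, not_not, Avoids, not_or, not_or, not_not, not_not, not_not, height, sub_eq_zero,
    uNorm, vNorm, Real.sqrt_inj hu hv, T, Set.mem_ofPred_eq, mem_sphere_zero_iff_norm]
  refine ⟨fun ⟨_, h1, h2⟩ => ⟨h1.trans h2.symm, ?_, ?_⟩, fun ⟨h, h5, h6⟩ => ⟨hx, ?_, ?_⟩⟩
  · exact pow_eq_zero_iff two_ne_zero |>.1 (by nlinarith [sq_nonneg (x 5), sq_nonneg (x 6)])
  · exact pow_eq_zero_iff two_ne_zero |>.1 (by nlinarith [sq_nonneg (x 5), sq_nonneg (x 6)])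
  · rw [h5, h6] at hs; linarith
  · rw [h5, h6] at hs; linarith

theorem normalize_mem {x : E 7} (hx : Avoids x) :
    ‖x‖⁻¹ • x ∈ Metric.sphere (0 : E 7) 1 \ T :=
  mem_complement_iff.2 ⟨norm_smul_inv_norm (𝕜 := ℝ) hx.ne_zero,
    hx.smul (inv_pos.2 (norm_pos_iff.2 hx.ne_zero))⟩

/-- The complement of `T` in the sphere. -/
abbrev sphereDiff : Set (E 7) := Metric.sphere (0 : E 7) 1 \ T

/-- The radial projection of a square of vectors avoiding the cone over `T`. -/
def normLoop (k : (Fin 2 → I) → E 7) (hk : Continuous k) (hav : ∀ y, Avoids (k y))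
    (hb : ∀ y ∈ Cube.boundary (Fin 2), k y = basePoint.1) : Ω^ (Fin 2) sphereDiff basePoint :=
  ⟨⟨fun y => ⟨‖k y‖⁻¹ • k y, normalize_mem (hav y)⟩,
    ((hk.norm.inv₀ fun y => norm_ne_zero_iff.2 (hav y).ne_zero).smul hk).subtype_mk _⟩,
    fun y hy => Subtype.ext (by simp [hb y hy, basePoint])⟩

theorem normLoop_apply {k : (Fin 2 → I) → E 7} {hk : Continuous k} {hav : ∀ y, Avoids (k y)}
    {hb : ∀ y ∈ Cube.boundary (Fin 2), k y = basePoint.1} (y : Fin 2 → I) :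
    (normLoop k hk hav hb y).1 = ‖k y‖⁻¹ • k y := rfl

theorem homotopic_of_avoids {f g : Ω^ (Fin 2) sphereDiff basePoint} {h : I × (Fin 2 → I) → E 7}
    (hc : Continuous h) (hav : ∀ z, Avoids (h z))
    (hb : ∀ t, ∀ y ∈ Cube.boundary (Fin 2), h (t, y) = basePoint.1)
    (hf : ∀ y, (f y).1 = ‖h (0, y)‖⁻¹ • h (0, y)) (hg : ∀ y, (g y).1 = ‖h (1, y)‖⁻¹ • h (1, y)) :
    GenLoop.Homotopic f g :=
  ⟨{ toFun := fun z => ⟨‖h z‖⁻¹ • h z, normalize_mem (hav z)⟩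
     continuous_toFun :=
      ((hc.norm.inv₀ fun y => norm_ne_zero_iff.2 (hav y).ne_zero).smul hc).subtype_mk _
     map_zero_left := fun y => Subtype.ext (hf y).symm
     map_one_left := fun y => Subtype.ext (hg y).symm
     prop' := fun t y hy => Subtype.ext (by
      change ‖h (t, y)‖⁻¹ • h (t, y) = (f y).1
      rw [hf, hb t y hy, hb 0 y hy]) }⟩

/-- The map to imaginary quaternions whose zero set is the cone over `T`. -/
def toQuat (x : E 7) : ℍ[ℝ] := ⟨0, height x, x 5, x 6⟩

/-- A section of `toQuat` over the imaginary quaternions. -/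
def fromQuat (q : ℍ[ℝ]) : E 7 := !₂[max q.imI 0, 0, 0, max (-q.imI) 0, 0, q.imJ, q.imK]

@[fun_prop]
theorem continuous_toQuat : Continuous toQuat := by
  have h (q : ℍ[ℝ]) {f : E 7 → ℝ} (hf : Continuous f) : Continuous fun x => f x • q :=
    hf.smul continuous_const
  have : toQuat = fun x => height x • (⟨0, 1, 0, 0⟩ : ℍ[ℝ]) + x 5 • (⟨0, 0, 1, 0⟩ : ℍ[ℝ])
      + x 6 • (⟨0, 0, 0, 1⟩ : ℍ[ℝ]) := by
    funext x
    ext <;> simp [toQuat]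
  rw [this]
  exact ((h _ continuous_height).add (h _ (by fun_prop))).add (h _ (by fun_prop))

@[fun_prop]
theorem continuous_fromQuat : Continuous fromQuat := by
  have := Quaternion.continuous_imI
  have := Quaternion.continuous_imJ
  have := Quaternion.continuous_imK
  unfold fromQuat
  fun_prop

theorem height_fromQuat (q : ℍ[ℝ]) : height (fromQuat q) = q.imI := by
  simp only [height, uNorm, vNorm, fromQuat]
  simp

theorem toQuat_fromQuat {q : ℍ[ℝ]} (hq : q.re = 0) : toQuat (fromQuat q) = q := by
  ext
  · exact hq.symm
  · exact height_fromQuat q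
  · rfl
  · rfl

theorem avoids_fromQuat {q : ℍ[ℝ]} (hq : q.re = 0) (h0 : q ≠ 0) : Avoids (fromQuat q) := by
  by_contra h
  simp only [Avoids, height_fromQuat, not_or, not_not] at h
  exact h0 (by ext; exacts [hq, h.1, h.2.1, h.2.2])

theorem toQuat_ne_zero {x : E 7} (hx : Avoids x) : toQuat x ≠ 0 := fun h => by
  rcases hx with h1 | h1 | h1
  exacts [h1 (congrArg QuaternionAlgebra.imI h), h1 (congrArg QuaternionAlgebra.imJ h),
    h1 (congrArg QuaternionAlgebra.imK h)]

theorem toQuat_smul {c : ℝ} (hc : 0 ≤ c) (x : E 7) : toQuat (c • x) = c • toQuat x := by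
  ext
  · exact (mul_zero c).symm
  · exact height_smul hc x
  · rfl
  · rfl

theorem re_eq_zero_of_mul_self {q : ℍ[ℝ]} (hq : q * q = -1) : q.re = 0 := by
  have h0 := congrArg QuaternionAlgebra.re hq
  have h1 := congrArg QuaternionAlgebra.imI hq
  have h2 := congrArg QuaternionAlgebra.imJ hq
  have h3 := congrArg QuaternionAlgebra.imK hq
  simp at h0 h1 h2 h3
  by_contra hr
  have e1 : q.imI = 0 := mul_left_cancel₀ hr (by linarith)
  have e2 : q.imJ = 0 := mul_left_cancel₀ hr (by linarith)
  have e3 : q.imK = 0 := mul_left_cancel₀ hr (by linarith)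
  rw [e1, e2, e3] at h0
  nlinarith

theorem norm_eq_one_of_mul_self {q : ℍ[ℝ]} (hq : q * q = -1) : ‖q‖ = 1 := by
  have h : ‖q‖ * ‖q‖ = 1 := by rw [← norm_mul, hq, norm_neg, norm_one]
  nlinarith [norm_nonneg q]

theorem normalize_mul_self {q : ℍ[ℝ]} (hq : q.re = 0) (h0 : q ≠ 0) :
    (‖q‖⁻¹ • q) * (‖q‖⁻¹ • q) = -1 := by
  have h1 : q * q = -((‖q‖ * ‖q‖ : ℝ) : ℍ[ℝ]) := by
    have hs : star q = -q := by ext <;> simp [hq]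
    rw [← Quaternion.normSq_eq_norm_mul_self, ← Quaternion.self_mul_star, hs]
    simp
  have h2 : ‖q‖ ≠ 0 := norm_ne_zero_iff.2 h0
  rw [smul_mul_smul_comm, h1, smul_neg, ← Quaternion.coe_mul_eq_smul, ← Quaternion.coe_mul]
  rw [show ‖q‖⁻¹ * ‖q‖⁻¹ * (‖q‖ * ‖q‖) = 1 by field_simp, Quaternion.coe_one]

theorem fromQuat_quatI : fromQuat quatI = basePoint.1 := by
  ext i
  fin_cases i <;> simp [fromQuat, basePoint]

theorem toQuat_basePoint : toQuat basePoint.1 = quatI := by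
  rw [← fromQuat_quatI, toQuat_fromQuat (by simp)]

theorem height_mk {c d : ℝ} (hc : 0 ≤ c) (hd : 0 ≤ d) (x : E 7) (a b : ℝ) :
    height !₂[c * x 0, c * x 1, c * x 2, d * x 3, d * x 4, a, b] = c * uNorm x - d * vNorm x := by
  have h1 : (c * x 0) ^ 2 + (c * x 1) ^ 2 + (c * x 2) ^ 2
      = c ^ 2 * (x 0 ^ 2 + x 1 ^ 2 + x 2 ^ 2) := by ring
  have h2 : (d * x 3) ^ 2 + (d * x 4) ^ 2 = d ^ 2 * (x 3 ^ 2 + x 4 ^ 2) := by ring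
  change √((c * x 0) ^ 2 + (c * x 1) ^ 2 + (c * x 2) ^ 2) - √((d * x 3) ^ 2 + (d * x 4) ^ 2) = _
  rw [h1, h2, Real.sqrt_mul (sq_nonneg c), Real.sqrt_mul (sq_nonneg d), Real.sqrt_sq hc,
    Real.sqrt_sq hd]
  rfl

theorem avoids_of_left {a b c d e : ℝ} (h : ![a, b, c, d, e] ≠ 0) :
    Avoids !₂[a, b, c, 0, 0, d, e] := by
  by_contra hn
  simp only [Avoids, not_or, not_not] at hn
  obtain ⟨h1, h2, h3⟩ := hn
  change √(a ^ 2 + b ^ 2 + c ^ 2) - √(0 ^ 2 + 0 ^ 2) = 0 at h1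
  have h4 : a ^ 2 + b ^ 2 + c ^ 2 = 0 := by
    rw [← Real.sqrt_eq_zero (by positivity)]
    simpa using h1
  have ha : a = 0 := by nlinarith
  have hb : b = 0 := by nlinarith
  have hc : c = 0 := by nlinarith
  change d = 0 at h2
  change e = 0 at h3
  apply h
  ext i
  fin_cases i <;> simp [ha, hb, hc, h2, h3]

theorem avoids_of_right {a b d e : ℝ} (h : ![a, b, d, e] ≠ 0) :
    Avoids !₂[0, 0, 0, a, b, d, e] := by
  by_contra hn
  simp only [Avoids, not_or, not_not] at hn
  obtain ⟨h1, h2, h3⟩ := hn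
  change √(0 ^ 2 + 0 ^ 2 + 0 ^ 2) - √(a ^ 2 + b ^ 2) = 0 at h1
  have h4 : a ^ 2 + b ^ 2 = 0 := by
    rw [← Real.sqrt_eq_zero (by positivity)]
    simpa using h1
  have ha : a = 0 := by nlinarith
  have hb : b = 0 := by nlinarith
  change d = 0 at h2
  change e = 0 at h3
  apply h
  ext i
  fin_cases i <;> simp [ha, hb, h2, h3]

end Geometry

section Classification

open unitInterval Quaternion Topology Topology.Homotopy

theorem avoids_loop (f : Ω^ (Fin 2) sphereDiff basePoint) (y : Fin 2 → I) : Avoids (f y).1 :=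
  (mem_complement_iff.1 (f y).2).2

theorem norm_loop (f : Ω^ (Fin 2) sphereDiff basePoint) (y : Fin 2 → I) : ‖(f y).1‖ = 1 :=
  (mem_complement_iff.1 (f y).2).1

theorem continuous_loop (f : Ω^ (Fin 2) sphereDiff basePoint) : Continuous fun y => (f y).1 :=
  continuous_subtype_val.comp f.1.continuous

theorem loop_boundary (f : Ω^ (Fin 2) sphereDiff basePoint) {y : Fin 2 → I}
    (hy : y ∈ Cube.boundary (Fin 2)) : (f y).1 = basePoint.1 :=
  congrArg Subtype.val (f.2 y hy)

theorem height_basePoint : height basePoint.1 = 1 := by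
  have := congrArg QuaternionAlgebra.imI toQuat_basePoint
  simpa [toQuat] using this

/-- Scale the first block by the positive part of the height and the second block by the negative
part. -/
def pinch (t : ℝ) (x : E 7) : E 7 :=
  let c := (1 - t) + t * max (height x) 0
  let d := (1 - t) + t * max (-height x) 0
  !₂[c * x 0, c * x 1, c * x 2, d * x 3, d * x 4, x 5, x 6]

theorem continuous_pinch : Continuous fun z : ℝ × E 7 => pinch z.1 z.2 := by
  have := continuous_height
  unfold pinch
  fun_prop

theorem pinch_zero (x : E 7) : pinch 0 x = x := by
  ext i
  fin_cases i <;> simp [pinch]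

theorem pinch_basePoint (t : ℝ) : pinch t basePoint.1 = basePoint.1 := by
  ext i
  simp only [pinch, height_basePoint]
  fin_cases i <;> simp [basePoint]

theorem uNorm_nonneg (x : E 7) : 0 ≤ uNorm x := Real.sqrt_nonneg _

theorem vNorm_nonneg (x : E 7) : 0 ≤ vNorm x := Real.sqrt_nonneg _

theorem avoids_pinch {t : ℝ} (h0 : 0 ≤ t) (h1 : t ≤ 1) {x : E 7} (hx : Avoids x) :
    Avoids (pinch t x) := by
  rcases hx with h | h | h
  · left
    have hc : 0 ≤ (1 - t) + t * max (height x) 0 := by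
      have := mul_nonneg h0 (le_max_right (height x) 0); linarith
    have hd : 0 ≤ (1 - t) + t * max (-height x) 0 := by
      have := mul_nonneg h0 (le_max_right (-height x) 0); linarith
    unfold pinch
    rw [height_mk hc hd]
    have hu := uNorm_nonneg x
    have hv := vNorm_nonneg x
    have e : uNorm x = height x + vNorm x := by rw [height]; ring
    have key {a b : ℝ} (ha : 0 < a) (hb : 0 ≤ b) : 0 < (1 - t) * a + t * a * (a + b) := by
      rcases h0.eq_or_lt with rfl | h0
      · simpa using ha
      · have : 0 < t * a * (a + b) := by positivity
        have := mul_nonneg (sub_nonneg.2 h1) ha.le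
        linarith
    rcases h.lt_or_gt with h | h
    · rw [max_eq_right h.le, max_eq_left (by linarith)]
      have := key (neg_pos.2 h) hu
      refine ne_of_lt ?_
      rw [e] at this ⊢
      linarith
    · rw [max_eq_left h.le, max_eq_right (by linarith)]
      have := key h hv
      refine ne_of_gt ?_
      rw [e]
      linarith
  · exact Or.inr (Or.inl h)
  · exact Or.inr (Or.inr h)

/-- The pinched loop. -/
def pinchLoop (f : Ω^ (Fin 2) sphereDiff basePoint) : Ω^ (Fin 2) sphereDiff basePoint :=
  normLoop (fun y => pinch 1 (f y).1)
    (continuous_pinch.comp (continuous_const.prodMk (continuous_loop f)))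
    (fun y => avoids_pinch zero_le_one le_rfl (avoids_loop f y))
    (fun y hy => by simp only [loop_boundary f hy, pinch_basePoint])

theorem homotopic_pinchLoop (f : Ω^ (Fin 2) sphereDiff basePoint) :
    GenLoop.Homotopic f (pinchLoop f) := by
  refine homotopic_of_avoids (h := fun z => pinch z.1 (f z.2).1) ?_
    (fun z => avoids_pinch z.1.2.1 z.1.2.2 (avoids_loop f z.2)) ?_ ?_ ?_
  · exact continuous_pinch.comp ((continuous_subtype_val.comp continuous_fst).prodMk
      ((continuous_loop f).comp continuous_snd))
  · intro t y hy
    simp only [loop_boundary f hy, pinch_basePoint]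
  · intro y
    simp [pinch_zero, norm_loop]
  · intro y
    rfl

/-- The loop in the image of `fromQuat` obtained from a loop. -/
def quatLoop (f : Ω^ (Fin 2) sphereDiff basePoint) : Ω^ (Fin 2) sphereDiff basePoint :=
  normLoop (fun y => fromQuat (toQuat (f y).1))
    (continuous_fromQuat.comp (continuous_toQuat.comp (continuous_loop f)))
    (fun y => avoids_fromQuat rfl (toQuat_ne_zero (avoids_loop f y)))
    (fun y hy => by simp only [loop_boundary f hy, toQuat_basePoint, fromQuat_quatI])

theorem uNorm_pos_of_height_pos {x : E 7} (h : 0 < height x) : x 0 ≠ 0 ∨ x 1 ≠ 0 ∨ x 2 ≠ 0 := by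
  by_contra hn
  simp only [not_or, not_not] at hn
  have : uNorm x = 0 := by simp [uNorm, hn]
  have := vNorm_nonneg x
  rw [height] at h
  linarith

theorem vNorm_pos_of_height_neg {x : E 7} (h : height x < 0) : x 3 ≠ 0 ∨ x 4 ≠ 0 := by
  by_contra hn
  simp only [not_or, not_not] at hn
  have : vNorm x = 0 := by simp [vNorm, hn]
  have := uNorm_nonneg x
  rw [height] at h
  linarith

/-- Pushing the first block of a pinched vector towards the first axis. -/
def leftPush (t : ℝ) (x : E 7) : Fin 5 → ℝ :=
  ![(1 - t) * (max (height x) 0 * x 0) + t * max (height x) 0 + max (-height x) 0,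
    (1 - t) * (max (height x) 0 * x 1), (1 - t) * (max (height x) 0 * x 2), x 5, x 6]

/-- Pushing the second block of a pinched vector towards the fourth axis. -/
def rightPush (t : ℝ) (x : E 7) : Fin 4 → ℝ :=
  ![(1 - t) * (max (-height x) 0 * x 3) + t * max (-height x) 0 + max (height x) 0,
    (1 - t) * (max (-height x) 0 * x 4), x 5, x 6]

theorem leftPush_ne_zero {t : ℝ} {x : E 7} (hx : Avoids x)
    (h : t = 0 ∨ t = 1 ∨ x = basePoint.1 ∨ height x ≤ 0) : leftPush t x ≠ 0 := by
  intro h0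
  have e0 := congrFun h0 0
  have e1 := congrFun h0 1
  have e2 := congrFun h0 2
  have e3 : x 5 = 0 := congrFun h0 3
  have e4 : x 6 = 0 := congrFun h0 4
  simp only [leftPush, Matrix.cons_val, Pi.zero_apply] at e0 e1 e2
  have ha : height x ≠ 0 := by simpa [Avoids, e3, e4] using hx
  rcases ha.lt_or_gt with ha | ha
  · rw [max_eq_right ha.le, max_eq_left (by linarith)] at e0
    exact ha.ne (by linarith)
  · rw [max_eq_left ha.le] at e0 e1 e2
    rw [max_eq_right (by linarith)] at e0
    rcases h with rfl | rfl | rfl | h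
    · simp [ha.ne'] at e0 e1 e2
      rcases uNorm_pos_of_height_pos ha with h | h | h <;> contradiction
    · simp [ha.ne'] at e0
    · rw [height_basePoint] at e0
      simp [basePoint] at e0
    · linarith

theorem rightPush_ne_zero {t : ℝ} {x : E 7} (hx : Avoids x)
    (h : t = 0 ∨ t = 1 ∨ 0 ≤ height x) : rightPush t x ≠ 0 := by
  intro h0
  have e0 := congrFun h0 0
  have e1 := congrFun h0 1
  have e3 : x 5 = 0 := congrFun h0 2
  have e4 : x 6 = 0 := congrFun h0 3
  simp only [rightPush, Matrix.cons_val, Pi.zero_apply] at e0 e1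
  have ha : height x ≠ 0 := by simpa [Avoids, e3, e4] using hx
  rcases ha.lt_or_gt with ha | ha
  · rw [max_eq_left (by linarith)] at e0 e1
    rw [max_eq_right ha.le] at e0
    rcases h with rfl | rfl | h
    · simp [ha.ne] at e0 e1
      rcases vNorm_pos_of_height_neg ha with h | h <;> contradiction
    · simp [ha.ne] at e0
    · linarith
  · rw [max_eq_left ha.le, max_eq_right (by linarith)] at e0
    exact ha.ne' (by linarith)

theorem continuous_leftPush : Continuous fun z : ℝ × E 7 => leftPush z.1 z.2 := by
  have := continuous_height
  unfold leftPush
  refine continuous_pi fun i => ?_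
  fin_cases i <;> simp <;> fun_prop

theorem continuous_rightPush : Continuous fun z : ℝ × E 7 => rightPush z.1 z.2 := by
  have := continuous_height
  unfold rightPush
  refine continuous_pi fun i => ?_
  fin_cases i <;> simp <;> fun_prop

theorem homotopic_pinchLoop_quatLoop (f : Ω^ (Fin 2) sphereDiff basePoint) :
    GenLoop.Homotopic (pinchLoop f) (quatLoop f) := by
  have hparam : Continuous fun z : I × (Fin 2 → I) => ((z.1 : ℝ), (f z.2).1) :=
    (continuous_subtype_val.comp continuous_fst).prodMk ((continuous_loop f).comp continuous_snd)
  have hheight : Continuous fun z : I × (Fin 2 → I) => height (f z.2).1 :=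
    continuous_height.comp ((continuous_loop f).comp continuous_snd)
  have ht0 : IsClosed {z : I × (Fin 2 → I) | z.1 = 0} := isClosed_eq continuous_fst continuous_const
  have ht1 : IsClosed {z : I × (Fin 2 → I) | z.1 = 1} := isClosed_eq continuous_fst continuous_const
  obtain ⟨P, hP, hP0, hPe⟩ := exists_nonvanishing_eqOn (V := Fin 5 → ℝ) (by simp)
    (continuous_leftPush.comp hparam)
    (C := {z | z.1 = 0} ∪ ({z | z.1 = 1} ∪ ({z | z.2 ∈ Cube.boundary (Fin 2)} ∪
      {z | height (f z.2).1 ≤ 0})))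
    (ht0.union (ht1.union ((isClosed_cubeBoundary.preimage continuous_snd).union
      (isClosed_le hheight continuous_const))))
    (by
      intro z hz
      refine leftPush_ne_zero (avoids_loop f z.2) ?_
      rcases hz with hz | hz | hz | hz
      · exact Or.inl (congrArg Subtype.val hz)
      · exact Or.inr (Or.inl (congrArg Subtype.val hz))
      · exact Or.inr (Or.inr (Or.inl (loop_boundary f hz)))
      · exact Or.inr (Or.inr (Or.inr hz)))
  obtain ⟨R, hR, hR0, hRe⟩ := exists_nonvanishing_eqOn (V := Fin 4 → ℝ) (by simp)
    (continuous_rightPush.comp hparam)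
    (C := {z | z.1 = 0} ∪ ({z | z.1 = 1} ∪ {z | 0 ≤ height (f z.2).1}))
    (ht0.union (ht1.union (isClosed_le continuous_const hheight)))
    (by
      intro z hz
      refine rightPush_ne_zero (avoids_loop f z.2) ?_
      rcases hz with hz | hz | hz
      · exact Or.inl (congrArg Subtype.val hz)
      · exact Or.inr (Or.inl (congrArg Subtype.val hz))
      · exact Or.inr (Or.inr hz))
  let h : I × (Fin 2 → I) → E 7 := fun z => if 0 ≤ height (f z.2).1 then
    !₂[P z 0, P z 1, P z 2, 0, 0, P z 3, P z 4] else !₂[0, 0, 0, R z 0, R z 1, R z 2, R z 3]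
  have h_zero (y) : h (0, y) = pinch 1 (f y).1 := by
    simp only [h]
    split_ifs with hs
    · rw [hPe (0, y) (Or.inl rfl)]
      ext i
      fin_cases i <;> simp [leftPush, pinch, hs]
    · rw [hRe (0, y) (Or.inl rfl)]
      ext i
      fin_cases i <;> simp [rightPush, pinch, (not_le.1 hs).le]
  have h_one (y) : h (1, y) = fromQuat (toQuat (f y).1) := by
    simp only [h]
    split_ifs with hs
    · rw [hPe (1, y) (Or.inr (Or.inl rfl))]
      ext i
      fin_cases i <;> simp [leftPush, fromQuat, toQuat, hs]
    · rw [hRe (1, y) (Or.inr (Or.inl rfl))]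
      ext i
      fin_cases i <;> simp [rightPush, fromQuat, toQuat, (not_le.1 hs).le]
  refine homotopic_of_avoids (h := h) ?_ ?_ ?_ ?_ ?_
  · refine Continuous.if_le ?_ ?_ continuous_const hheight ?_
    · fun_prop
    · fun_prop
    · intro z hz
      rw [hPe z (Or.inr (Or.inr (Or.inr hz.ge))), hRe z (Or.inr (Or.inr hz.le))]
      ext i
      fin_cases i <;> simp [leftPush, rightPush, ← hz]
  · intro z
    simp only [h]
    split_ifs with hs
    · refine avoids_of_left fun h0 => hP0 z (Eq.trans ?_ h0)
      ext i
      fin_cases i <;> rfl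
    · refine avoids_of_right fun h0 => hR0 z (Eq.trans ?_ h0)
      ext i
      fin_cases i <;> rfl
  · intro t y hy
    simp only [h]
    rw [loop_boundary f hy, height_basePoint, if_pos zero_le_one,
      hPe (t, y) (Or.inr (Or.inr (Or.inl hy)))]
    ext i
    simp only [Function.comp, leftPush, loop_boundary f hy, height_basePoint]
    fin_cases i <;> simp [basePoint]
  · intro y
    rw [h_zero]
    rfl
  · intro y
    rw [h_one]
    rfl

/-- The composition of a loop with the radial projection of `toQuat` to the unit sphere. -/
def loopQuat (f : Ω^ (Fin 2) sphereDiff basePoint) (y : Fin 2 → I) : ℍ[ℝ] :=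
  ‖toQuat (f y).1‖⁻¹ • toQuat (f y).1

theorem continuous_normalize_toQuat :
    Continuous fun x : sphereDiff => ‖toQuat x.1‖⁻¹ • toQuat x.1 := by
  have h : Continuous fun x : sphereDiff => toQuat x.1 :=
    continuous_toQuat.comp continuous_subtype_val
  exact (h.norm.inv₀ fun x => norm_ne_zero_iff.2
    (toQuat_ne_zero (mem_complement_iff.1 x.2).2)).smul h

theorem normalize_toQuat_mul_self (x : sphereDiff) :
    (‖toQuat x.1‖⁻¹ • toQuat x.1) * (‖toQuat x.1‖⁻¹ • toQuat x.1) = -1 :=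
  normalize_mul_self rfl (toQuat_ne_zero (mem_complement_iff.1 x.2).2)

theorem norm_quatI : ‖quatI‖ = 1 := norm_eq_one_of_mul_self quatI_mul_self

theorem loopQuat_boundary (f : Ω^ (Fin 2) sphereDiff basePoint) {y : Fin 2 → I}
    (hy : y ∈ Cube.boundary (Fin 2)) : loopQuat f y = quatI := by
  simp only [loopQuat, loop_boundary f hy, toQuat_basePoint, norm_quatI, inv_one, one_smul]

theorem exists_isDegree_loopQuat (f : Ω^ (Fin 2) sphereDiff basePoint) :
    ∃ n, IsDegree (loopQuat f) n :=
  exists_isDegree (continuous_normalize_toQuat.comp f.1.continuous)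
    (fun y => normalize_toQuat_mul_self (f y)) fun _ hy => loopQuat_boundary f hy

theorem isDegree_loopQuat_of_homotopic {f g : Ω^ (Fin 2) sphereDiff basePoint}
    (h : GenLoop.Homotopic f g) {n : ℤ} (hf : IsDegree (loopQuat f) n) :
    IsDegree (loopQuat g) n := by
  obtain ⟨H⟩ := h
  have e0 : (fun y => ‖toQuat (H (0, y)).1‖⁻¹ • toQuat (H (0, y)).1) = loopQuat f := by
    funext y
    rw [H.apply_zero]
    rfl
  have e1 : (fun y => ‖toQuat (H (1, y)).1‖⁻¹ • toQuat (H (1, y)).1) = loopQuat g := by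
    funext y
    rw [H.apply_one]
    rfl
  rw [← e1]
  refine IsDegree.of_homotopy (H := fun z => ‖toQuat (H z).1‖⁻¹ • toQuat (H z).1)
    (continuous_normalize_toQuat.comp H.continuous) (fun z => normalize_toQuat_mul_self (H z))
    (fun t y hy => ?_) (by rw [e0]; exact hf)
  rw [H.eq_fst t hy, H.eq_fst 0 hy]

theorem quatLoop_homotopic_const {f : Ω^ (Fin 2) sphereDiff basePoint}
    (h : IsDegree (loopQuat f) 0) : GenLoop.Homotopic (quatLoop f) GenLoop.const := by
  obtain ⟨Γ, hΓ, hΓ1, hΓ0, hΓe, hΓb⟩ := h.exists_nullhomotopy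
  have hn (y) : 0 < ‖toQuat (f y).1‖ := norm_pos_iff.2 (toQuat_ne_zero (avoids_loop f y))
  have hpos (z : I × (Fin 2 → I)) : 0 < (1 - (z.1 : ℝ)) * ‖toQuat (f z.2).1‖ + z.1 := by
    rcases z.1.2.1.eq_or_lt with h0 | h0
    · rw [← h0]
      simpa using hn z.2
    · have := mul_nonneg (sub_nonneg.2 z.1.2.2) (hn z.2).le
      linarith
  have hq : Continuous fun y => toQuat (f y).1 := continuous_toQuat.comp (continuous_loop f)
  refine homotopic_of_avoids (h := fun z => fromQuat
    (((1 - (z.1 : ℝ)) * ‖toQuat (f z.2).1‖ + z.1) • Γ z)) ?_ ?_ ?_ ?_ ?_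
  · have hq' : Continuous fun z : I × (Fin 2 → I) => ‖toQuat (f z.2).1‖ :=
      (hq.comp continuous_snd).norm
    have ht : Continuous fun z : I × (Fin 2 → I) => (z.1 : ℝ) :=
      continuous_subtype_val.comp continuous_fst
    have hc : Continuous fun z : I × (Fin 2 → I) =>
        (1 - (z.1 : ℝ)) * ‖toQuat (f z.2).1‖ + z.1 := ((continuous_const.sub ht).mul hq').add ht
    exact continuous_fromQuat.comp (hc.smul hΓ)
  · intro z
    have hne : Γ z ≠ 0 := fun h0 => by simpa [h0] using hΓ1 z
    refine avoids_fromQuat ?_ (smul_ne_zero (hpos z).ne' hne)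
    simp [re_eq_zero_of_mul_self (hΓ1 z)]
  · intro t y hy
    simp only [hΓb t y hy, loop_boundary f hy, toQuat_basePoint, norm_quatI]
    simp only [mul_one, sub_add_cancel, one_smul, fromQuat_quatI]
  · intro y
    have e : ((1 - ((0 : I) : ℝ)) * ‖toQuat (f y).1‖ + ((0 : I) : ℝ)) • Γ (0, y)
        = toQuat (f y).1 := by
      rw [hΓ0, loopQuat, smul_smul]
      simp [(hn y).ne']
    simp only [e]
    rfl
  · intro y
    have e : ((1 - ((1 : I) : ℝ)) * ‖toQuat (f y).1‖ + ((1 : I) : ℝ)) • Γ (1, y) = quatI := by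
      rw [hΓe]
      simp
    simp only [e, fromQuat_quatI]
    change basePoint.1 = _
    rw [(mem_complement_iff.1 basePoint.2).1, inv_one, one_smul]

theorem homotopic_const_of_isDegree_zero {f : Ω^ (Fin 2) sphereDiff basePoint}
    (h : IsDegree (loopQuat f) 0) : GenLoop.Homotopic f GenLoop.const :=
  ((homotopic_pinchLoop f).trans (homotopic_pinchLoop_quatLoop f)).trans
    (quatLoop_homotopic_const h)

theorem exists_loop_of_degree (n : ℤ) :
    ∃ f : Ω^ (Fin 2) sphereDiff basePoint, IsDegree (loopQuat f) n := by
  obtain ⟨G, hG, hG1, hGb, hn⟩ := exists_of_degree n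
  have hre (y) : (G y).re = 0 := re_eq_zero_of_mul_self (hG1 y)
  have hne (y) : G y ≠ 0 := fun h0 => by simpa [h0] using hG1 y
  have hav (y) : Avoids (fromQuat (G y)) := avoids_fromQuat (hre y) (hne y)
  refine ⟨normLoop (fun y => fromQuat (G y)) (continuous_fromQuat.comp hG) hav
    (fun y hy => by simp only [hGb y hy, fromQuat_quatI]), ?_⟩
  convert hn using 1
  funext y
  have hpos : 0 < ‖fromQuat (G y)‖⁻¹ := inv_pos.2 (norm_pos_iff.2 (hav y).ne_zero)
  rw [loopQuat, normLoop_apply, toQuat_smul hpos.le, toQuat_fromQuat (hre y), norm_smul,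
    norm_eq_one_of_mul_self (hG1 y), mul_one, smul_smul, norm_inv, norm_norm, inv_inv,
    mul_inv_cancel₀ (inv_pos.1 hpos).ne', one_smul]

/-- The degree of a homotopy class. -/
def classDegree : HomotopyGroup (Fin 2) sphereDiff basePoint → Multiplicative ℤ :=
  Quotient.lift (fun f => Multiplicative.ofAdd (exists_isDegree_loopQuat f).choose) fun f g h =>
    congrArg Multiplicative.ofAdd (IsDegree.unique
      (isDegree_loopQuat_of_homotopic h (exists_isDegree_loopQuat f).choose_spec)
      (exists_isDegree_loopQuat g).choose_spec)

theorem classDegree_mk {f : Ω^ (Fin 2) sphereDiff basePoint} {n : ℤ}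
    (h : IsDegree (loopQuat f) n) : classDegree ⟦f⟧ = Multiplicative.ofAdd n :=
  congrArg Multiplicative.ofAdd (IsDegree.unique (exists_isDegree_loopQuat f).choose_spec h)

theorem classDegree_mul (a b : HomotopyGroup (Fin 2) sphereDiff basePoint) :
    classDegree (a * b) = classDegree a * classDegree b := by
  induction a using Quotient.inductionOn with | _ f
  induction b using Quotient.inductionOn with | _ g
  obtain ⟨m, hm⟩ := exists_isDegree_loopQuat f
  obtain ⟨n, hn⟩ := exists_isDegree_loopQuat g
  refine (congrArg classDegree
    (HomotopyGroup.mul_spec (i := (1 : Fin 2)) (p := f) (q := g))).trans ?_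
  refine Eq.trans ?_ (congrArg₂ (· * ·) (classDegree_mk hm) (classDegree_mk hn)).symm
  rw [← ofAdd_add, add_comm]
  refine classDegree_mk (hn.concat hm fun y => ?_)
  simp only [loopQuat, GenLoop.transAt, GenLoop.coe_copy]
  split_ifs <;> rfl

theorem classDegree_bijective : Function.Bijective (MonoidHom.mk' classDegree classDegree_mul) := by
  constructor
  · rw [injective_iff_map_eq_one]
    intro a ha
    induction a using Quotient.inductionOn with | _ f
    obtain ⟨n, hn⟩ := exists_isDegree_loopQuat f
    have h0 : n = 0 := by
      have := (classDegree_mk hn).symm.trans ha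
      simpa using this
    subst h0
    rw [HomotopyGroup.one_def]
    exact Quotient.sound (homotopic_const_of_isDegree_zero hn)
  · intro k
    obtain ⟨f, hf⟩ := exists_loop_of_degree k.toAdd
    exact ⟨⟦f⟧, classDegree_mk hf⟩

end Classification

theorem statement8 :
    Nonempty
      (HomotopyGroup (Fin 2) (Metric.sphere (0 : E 7) 1 \ T : Set (E 7)) basePoint
        ≃* Multiplicative ℤ) := by
  exact ⟨MulEquiv.ofBijective _ classDegree_bijective⟩
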